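/- Let ℂⁿ = H_S ⊕ H_C ⊕ H_Z be an orthogonal decomposition with orthogonal projections Π_S, Π_C, Π_Z. Let H ∈ M_n(ℂ) be Hermitian and L_1, …, L_r ∈ M_n(ℂ) with Π_S L_k Π_C = 0 and Π_S L_k Π_Z = 0 for every k. Then for every matrix ρ ∈ M_n(ℂ) with Π_Z ρ Π_Z = ρ (ρ supported in H_Z), the C–Z block of the Lindblad generator satisfies Π_C · 𝓛(ρ) · Π_Z = −i·(Π_C H Π_Z)·ρ + Σ_k [ (Π_C L_k Π_Z) ρ (Π_Z L_k† Π_Z) − (1/2)·((Π_C L_k Π_C)† (Π_C L_k Π_Z) + (Π_C L_k† Π_Z)(Π_Z L_k Π_Z)) · ρ ], where on the right-hand side ρ is regarded via its Z-block Π_Z ρ Π_Z = ρ. -/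

import Mathlib

open scoped Matrix ComplexOrder

noncomputable section

attribute [local instance] Matrix.normedAddCommGroup Matrix.normedSpace

abbrev Mat (n : ℕ) := Matrix (Fin n) (Fin n) ℂ

/-- The Lindblad generator `𝓛(ρ) = −i[H,ρ] + Σ_k (L_k ρ L_k† − ½(L_k† L_k ρ + ρ L_k† L_k))`. -/
def lindblad {n r : ℕ} (H : Mat n) (L : Fin r → Mat n) : Mat n →ₗ[ℂ] Mat n :=
  (-Complex.I) • (LinearMap.mulLeft ℂ H - LinearMap.mulRight ℂ H)
    + ∑ k, ((LinearMap.mulRight ℂ (L k)ᴴ).comp (LinearMap.mulLeft ℂ (L k))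
        - (1/2 : ℂ) • (LinearMap.mulLeft ℂ ((L k)ᴴ * L k)
            + LinearMap.mulRight ℂ ((L k)ᴴ * L k)))

/-- `evol H L t ρ = exp (t 𝓛) ρ`, the solution of the master equation at time `t`. -/
def evol {n r : ℕ} (H : Mat n) (L : Fin r → Mat n) (t : ℝ) (ρ : Mat n) : Mat n :=
  haveI : IsTopologicalRing (Mat n →L[ℂ] Mat n) := by
    have h {E : Type} [NormedAddCommGroup E] [NormedSpace ℂ E] :
        IsTopologicalRing (E →L[ℂ] E) := inferInstance
    exact h (E := Mat n)
  NormedSpace.exp ((t : ℂ) • (lindblad H L).toContinuousLinearMap) ρ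

/-- If `L` maps the range of `PZ` into the orthogonal complement of the range of `PS`, then the
`C–Z` block of `A * L` only involves the `C` and `Z` blocks of the factors. -/
lemma mul_block_of_sum_eq_one {R : Type*} [Ring R] {PS PC PZ L : R}
    (hCidem : PC * PC = PC) (hZidem : PZ * PZ = PZ) (hsum : PS + PC + PZ = 1)
    (hLZ : PS * L * PZ = 0) (A : R) :
    PC * A * PC * (PC * L * PZ) + PC * A * PZ * (PZ * L * PZ) = PC * (A * L) * PZ := by
  have hC : PC * A * PC * (PC * L * PZ) = PC * A * (PC * PC) * L * PZ := by noncomm_ring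
  have hZ : PC * A * PZ * (PZ * L * PZ) = PC * A * (PZ * PZ) * L * PZ := by noncomm_ring
  calc PC * A * PC * (PC * L * PZ) + PC * A * PZ * (PZ * L * PZ)
      = PC * A * (PS * L * PZ) + PC * A * PC * L * PZ + PC * A * PZ * L * PZ := by
        rw [hC, hZ, hCidem, hZidem, hLZ, mul_zero, zero_add]
    _ = PC * A * (PS + PC + PZ) * L * PZ := by noncomm_ring
    _ = PC * (A * L) * PZ := by rw [hsum, mul_one, mul_assoc PC A L]

/-- For the orthogonal decomposition `ℂⁿ = H_S ⊕ H_C ⊕ H_Z`, if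
`Π_S L_k Π_C = 0` and `Π_S L_k Π_Z = 0` for all `k`, then for any `ρ` supported in `H_Z`
the `C–Z` block of the Lindblad generator is given by the formula of Lemma 5 of the paper. -/
theorem lindblad_CZ_block {n r : ℕ}
    (PS PC PZ : Mat n)
    (hSH : PS.IsHermitian) (hCH : PC.IsHermitian) (hZH : PZ.IsHermitian)
    (hSidem : PS * PS = PS) (hCidem : PC * PC = PC) (hZidem : PZ * PZ = PZ)
    (hSC : PS * PC = 0) (hSZ : PS * PZ = 0) (hCZ : PC * PZ = 0)
    (hsum : PS + PC + PZ = 1)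
    (H : Mat n) (hH : H.IsHermitian) (L : Fin r → Mat n)
    (hLC : ∀ k, PS * L k * PC = 0) (hLZ : ∀ k, PS * L k * PZ = 0) :
    ∀ ρ : Mat n, PZ * ρ * PZ = ρ →
      PC * lindblad H L ρ * PZ =
        (-Complex.I) • (PC * H * PZ * ρ) +
          ∑ k, ((PC * L k * PZ) * ρ * (PZ * (L k)ᴴ * PZ) -
            (1/2 : ℂ) • (((PC * L k * PC)ᴴ * (PC * L k * PZ) +
              (PC * (L k)ᴴ * PZ) * (PZ * L k * PZ)) * ρ)) := by
  intro ρ hρ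
  have hZρ : PZ * ρ = ρ := by
    rw [← hρ, ← mul_assoc, ← mul_assoc, hZidem]
  have hρZ : ρ * PZ = ρ := by
    rw [← hρ, mul_assoc, hZidem]
  have hCρ : PC * ρ = 0 := by
    rw [← hZρ, ← mul_assoc, hCZ, zero_mul]
  have commutator : PC * (H * ρ - ρ * H) * PZ = PC * H * PZ * ρ := by
    rw [mul_sub, ← mul_assoc PC ρ, hCρ, zero_mul, sub_zero, mul_assoc _ PZ, hZρ,
      mul_assoc PC, mul_assoc H, hρZ, mul_assoc]
  have jump (k : Fin r) : PC * (L k * ρ * (L k)ᴴ) * PZ =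
      PC * L k * PZ * ρ * (PZ * (L k)ᴴ * PZ) := by
    calc PC * (L k * ρ * (L k)ᴴ) * PZ
        = PC * (L k * (PZ * ρ * PZ) * (L k)ᴴ) * PZ := by rw [hρ]
      _ = _ := by noncomm_ring
  have anticommutator (k : Fin r) :
      PC * ((L k)ᴴ * L k * ρ + ρ * ((L k)ᴴ * L k)) * PZ =
        ((PC * L k * PC)ᴴ * (PC * L k * PZ) + PC * (L k)ᴴ * PZ * (PZ * L k * PZ)) * ρ := by
    have hadj : (PC * L k * PC)ᴴ = PC * (L k)ᴴ * PC := by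
      rw [Matrix.conjTranspose_mul, Matrix.conjTranspose_mul, hCH.eq, mul_assoc]
    rw [hadj, mul_block_of_sum_eq_one hCidem hZidem hsum (hLZ k), mul_add,
      ← mul_assoc PC ρ, hCρ, zero_mul, add_zero, mul_assoc _ PZ, hZρ,
      mul_assoc PC, mul_assoc _ ρ, hρZ, mul_assoc PC]
  have hgen : lindblad H L ρ = (-Complex.I) • (H * ρ - ρ * H) +
      ∑ k, (L k * ρ * (L k)ᴴ - (1/2 : ℂ) • ((L k)ᴴ * L k * ρ + ρ * ((L k)ᴴ * L k))) := by
    simp [lindblad, LinearMap.sum_apply, mul_assoc]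
  rw [hgen, mul_add, add_mul, mul_smul_comm, smul_mul_assoc, commutator,
    Finset.mul_sum, Finset.sum_mul]
  congr 1
  refine Finset.sum_congr rfl fun k _ => ?_
  rw [mul_sub, sub_mul, mul_smul_comm, smul_mul_assoc, jump, anticommutator]
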